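/- Let n be a positive integer with n ≡ 1 (mod 4). Then the sum over k from 0 to n−1 of [8k+1] · (q;q^4)_k^4 / (q^4;q^4)_k^4 · q^{2k} is congruent to ((q^2;q^4)_{(n−1)/4} / (q^4;q^4)_{(n−1)/4}) · [n] · q^{(1−n)/4} modulo [n]·Φ_n(q)^2. -/

import Mathlib

open Polynomial Finset

/-- The q-shifted factorial `(x; r)_k = (1-x)(1-x r)⋯(1-x r^(k-1))`. -/
noncomputable def qPoch {F : Type*} [Field F] (x r : F) (k : ℕ) : F :=
  ∏ i ∈ Finset.range k, (1 - x * r ^ i)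

/-- The q-integer `[z] = (1-q^z)/(1-q)` (for an arbitrary integer `z`). -/
noncomputable def qInt {F : Type*} [Field F] (q : F) (z : ℤ) : F :=
  (1 - q ^ z) / (1 - q)

/-- The rational function `x ∈ ℚ(q)` is ≡ 0 modulo the polynomial `M`:
its numerator in lowest terms is divisible by `M`, i.e. `x = M·f/g` with `g` coprime to `M`. -/
def ratCongr (M : Polynomial ℚ) (x : RatFunc ℚ) : Prop :=
  ∃ f g : Polynomial ℚ, IsCoprime M g ∧
    x * algebraMap (Polynomial ℚ) (RatFunc ℚ) g =
      algebraMap (Polynomial ℚ) (RatFunc ℚ) M * algebraMap (Polynomial ℚ) (RatFunc ℚ) f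

/-- The rational function `x` is regular at `ζ`, with value `y`. -/
def HasValue (ζ : ℂ) (x : RatFunc ℚ) (y : ℂ) : Prop :=
  ∃ f g : ℚ[X], aeval ζ g ≠ 0 ∧ x * algebraMap ℚ[X] (RatFunc ℚ) g = algebraMap ℚ[X] (RatFunc ℚ) f ∧
    y * aeval ζ g = aeval ζ f

namespace HasValue

variable {ζ : ℂ} {x x' : RatFunc ℚ} {y y' : ℂ}

theorem congr_left (h : HasValue ζ x y) (hx : x' = x) : HasValue ζ x' y := hx ▸ h

theorem congr_right (h : HasValue ζ x y) (hy : y = y') : HasValue ζ x y' := hy ▸ h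

theorem ofPolynomial (ζ : ℂ) (f : ℚ[X]) :
    HasValue ζ (algebraMap ℚ[X] (RatFunc ℚ) f) (aeval ζ f) :=
  ⟨f, 1, by simp, by simp, by simp⟩

theorem one (ζ : ℂ) : HasValue ζ 1 1 := by simpa using ofPolynomial ζ 1

theorem zero (ζ : ℂ) : HasValue ζ 0 0 := by simpa using ofPolynomial ζ 0

theorem ratFuncX (ζ : ℂ) : HasValue ζ RatFunc.X ζ := by simpa using ofPolynomial ζ (X : ℚ[X])

theorem mul (h : HasValue ζ x y) (h' : HasValue ζ x' y') : HasValue ζ (x * x') (y * y') := by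
  obtain ⟨f, g, hg, hx, hy⟩ := h
  obtain ⟨f', g', hg', hx', hy'⟩ := h'
  refine ⟨f * f', g * g', by simp [hg, hg'], ?_, ?_⟩
  · rw [map_mul, map_mul, ← hx, ← hx']; ring
  · rw [map_mul, map_mul, ← hy, ← hy']; ring

theorem add (h : HasValue ζ x y) (h' : HasValue ζ x' y') : HasValue ζ (x + x') (y + y') := by
  obtain ⟨f, g, hg, hx, hy⟩ := h
  obtain ⟨f', g', hg', hx', hy'⟩ := h'
  refine ⟨f * g' + f' * g, g * g', by simp [hg, hg'], ?_, ?_⟩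
  · rw [map_add, map_mul, map_mul, map_mul, ← hx, ← hx']; ring
  · rw [map_add, map_mul, map_mul, map_mul, ← hy, ← hy']; ring

theorem neg (h : HasValue ζ x y) : HasValue ζ (-x) (-y) := by
  obtain ⟨f, g, hg, hx, hy⟩ := h
  exact ⟨-f, g, hg, by rw [map_neg, ← hx]; ring, by rw [map_neg, ← hy]; ring⟩

theorem sub (h : HasValue ζ x y) (h' : HasValue ζ x' y') : HasValue ζ (x - x') (y - y') := by
  simpa [sub_eq_add_neg] using h.add h'.neg

theorem ne_zero (h : HasValue ζ x y) (hy : y ≠ 0) : x ≠ 0 := by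
  rintro rfl
  obtain ⟨f, g, hg, hx, hy'⟩ := h
  rw [zero_mul, eq_comm, map_eq_zero_iff _ (RatFunc.algebraMap_injective ℚ)] at hx
  simp [hx, hy, hg] at hy'

theorem inv (h : HasValue ζ x y) (hy : y ≠ 0) : HasValue ζ x⁻¹ y⁻¹ := by
  have hx0 := h.ne_zero hy
  obtain ⟨f, g, hg, hx, hy'⟩ := h
  refine ⟨g, f, by rw [← hy']; exact mul_ne_zero hy hg, ?_, ?_⟩
  · rw [← hx]; field_simp
  · rw [← hy']; field_simp

theorem div (h : HasValue ζ x y) (h' : HasValue ζ x' y') (hy' : y' ≠ 0) :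
    HasValue ζ (x / x') (y / y') := by
  simpa [div_eq_mul_inv] using h.mul (h'.inv hy')

theorem pow (h : HasValue ζ x y) (k : ℕ) : HasValue ζ (x ^ k) (y ^ k) := by
  induction k with
  | zero => simpa using one ζ
  | succ k ih => simpa [pow_succ] using ih.mul h

theorem sum {ι : Type*} {s : Finset ι} {f : ι → RatFunc ℚ} {g : ι → ℂ}
    (h : ∀ i ∈ s, HasValue ζ (f i) (g i)) : HasValue ζ (∑ i ∈ s, f i) (∑ i ∈ s, g i) := by
  classical
  induction s using Finset.induction_on with
  | empty => simpa using zero ζ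
  | insert a s ha ih =>
    rw [sum_insert ha, sum_insert ha]
    exact (h a (by simp)).add (ih fun i hi => h i (by simp [hi]))

theorem prod {ι : Type*} {s : Finset ι} {f : ι → RatFunc ℚ} {g : ι → ℂ}
    (h : ∀ i ∈ s, HasValue ζ (f i) (g i)) : HasValue ζ (∏ i ∈ s, f i) (∏ i ∈ s, g i) := by
  classical
  induction s using Finset.induction_on with
  | empty => simpa using one ζ
  | insert a s ha ih =>
    rw [prod_insert ha, prod_insert ha]
    exact (h a (by simp)).mul (ih fun i hi => h i (by simp [hi]))

theorem one_sub_X_pow (ζ : ℂ) (k : ℕ) : HasValue ζ (1 - RatFunc.X ^ k) (1 - ζ ^ k) :=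
  (one ζ).sub ((ratFuncX ζ).pow k)

theorem exists_cyclotomic_mul {d : ℕ} (hd : 0 < d) (hζ : IsPrimitiveRoot ζ d)
    (h : HasValue ζ x 0) :
    ∃ z y', HasValue ζ z y' ∧ x = algebraMap ℚ[X] (RatFunc ℚ) (cyclotomic d ℚ) * z := by
  obtain ⟨f, g, hg, hx, hy⟩ := h
  rw [zero_mul, eq_comm] at hy
  obtain ⟨f', rfl⟩ : cyclotomic d ℚ ∣ f := by
    rw [cyclotomic_eq_minpoly_rat hζ hd]
    exact minpoly.dvd ℚ ζ hy
  refine ⟨_, _, (ofPolynomial ζ f').div (ofPolynomial ζ g) hg, ?_⟩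
  have := (ofPolynomial ζ g).ne_zero hg
  rw [map_mul] at hx
  field_simp
  linear_combination hx

theorem cyclotomic_pow_dvd_num {d : ℕ} (hd : 0 < d) (hζ : IsPrimitiveRoot ζ d)
    (h : HasValue ζ x y) (e : ℕ) :
    cyclotomic d ℚ ^ e ∣
      (algebraMap ℚ[X] (RatFunc ℚ) (cyclotomic d ℚ) ^ e * x).num := by
  obtain ⟨f, g, hg, hx, -⟩ := h
  set w := algebraMap ℚ[X] (RatFunc ℚ) (cyclotomic d ℚ) ^ e * x with hw
  have key : w.num * g = w.denom * (cyclotomic d ℚ ^ e * f) := by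
    apply RatFunc.algebraMap_injective ℚ
    have h0 : algebraMap ℚ[X] (RatFunc ℚ) w.denom ≠ 0 := by
      simpa using w.denom_ne_zero
    have h1 := RatFunc.num_div_denom w
    rw [div_eq_iff h0] at h1
    simp only [map_mul, map_pow]
    rw [h1, hw, ← hx]
    ring
  have hirr : Irreducible (cyclotomic d ℚ) := cyclotomic.irreducible_rat hd
  have hcop : IsCoprime (cyclotomic d ℚ) g := by
    rw [hirr.coprime_iff_not_dvd]
    rintro ⟨g', rfl⟩
    apply hg
    rw [map_mul, cyclotomic_eq_minpoly_rat hζ hd, minpoly.aeval, zero_mul]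
  refine (hcop.pow_left (m := e)).dvd_of_dvd_mul_right ?_
  rw [key]
  exact ⟨w.denom * f, by ring⟩

end HasValue

/-- Factor product of a very-well-poised `₆φ₅` series with base `r`. -/
noncomputable def wellPoised {F : Type*} [Field F] (r A e Y : F) (k : ℕ) : F :=
  ∏ i ∈ range k, r * (1 - A * r ^ i) ^ 2 * (e - r ^ i) * (Y - r ^ i) /
    ((1 - r ^ (i + 1)) ^ 2 * (1 - A * e * r ^ (i + 1)) * (1 - A * Y * r ^ (i + 1)))

section wellPoised

variable {F : Type*} [Field F] {r A e Y : F}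

theorem wellPoised_mul_succ (hr : ∀ i : ℕ, 1 - r ^ (i + 1) ≠ 0)
    (he : ∀ i : ℕ, 1 - A * e * r ^ (i + 1) ≠ 0) (hY : ∀ i : ℕ, 1 - A * Y * r ^ (i + 1) ≠ 0)
    (k : ℕ) :
    wellPoised r A e (r * Y) (k + 1) = wellPoised r A e Y k *
      (r * (1 - A * r ^ k) ^ 2 * (e - r ^ k) * (r * Y - 1) * r ^ k * (1 - A * Y * r) /
      ((1 - r ^ (k + 1)) ^ 2 * (1 - A * e * r ^ (k + 1)) * (1 - A * Y * r ^ (k + 1)) *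
        (1 - A * Y * r ^ (k + 2)))) := by
  induction k with
  | zero =>
    have h0 := hr 0
    have h1 := he 0
    have h2 := hY 0
    have h3 := hY 1
    simp only [wellPoised, prod_range_succ, prod_range_zero, pow_zero, zero_add, pow_one,
      one_mul, mul_one] at h0 h1 h2 ⊢
    norm_num at h3 ⊢
    have h4 : 1 - A * (r * Y) * r ≠ 0 := by convert h3 using 1; ring
    rw [show A * (r * Y) * r = A * Y * r ^ 2 by ring] at *
    generalize 1 - A * Y * r ^ 2 = B at *
    generalize 1 - A * Y * r = B' at *
    field_simp
  | succ k ih =>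
    have h0 := hr k
    have h0' := hr (k + 1)
    have h1 := he k
    have h1' := he (k + 1)
    have h2 := hY k
    have h2' := hY (k + 1)
    have h2'' := hY (k + 2)
    rw [wellPoised, prod_range_succ, ← wellPoised, ih, show wellPoised r A e Y (k + 1) = _ from prod_range_succ _ _,
      ← wellPoised]
    rw [show A * (r * Y) * r ^ (k + 1 + 1) = A * Y * r ^ (k + 2 + 1) by ring,
      show r * Y - r ^ (k + 1) = r * (Y - r ^ k) by ring]
    rw [show r ^ (k + 1 + 2) = r ^ (k + 2 + 1) by ring, show r ^ (k + 2) = r ^ (k + 1 + 1) by ring]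
    generalize 1 - A * Y * r ^ (k + 2 + 1) = B1 at *
    generalize 1 - A * Y * r ^ (k + 1 + 1) = B2 at *
    generalize 1 - A * Y * r ^ (k + 1) = B3 at *
    generalize 1 - A * e * r ^ (k + 1 + 1) = B4 at *
    generalize 1 - A * e * r ^ (k + 1) = B5 at *
    generalize 1 - r ^ (k + 1 + 1) = B6 at *
    generalize 1 - r ^ (k + 1) = B7 at *
    rw [pow_succ r k]
    clear ih hr he hY
    generalize r ^ k = x at *
    generalize 1 - A * (x * r) = a at *
    generalize e - x * r = b at *
    field_simp

theorem sum_wellPoised_sub (hr : ∀ i : ℕ, 1 - r ^ (i + 1) ≠ 0)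
    (he : ∀ i : ℕ, 1 - A * e * r ^ (i + 1) ≠ 0) (hY : ∀ i : ℕ, 1 - A * Y * r ^ (i + 1) ≠ 0)
    (m : ℕ) :
    (1 - r * Y) * (1 - A * e * (r * Y)) *
        ∑ k ∈ range (m + 1), (1 - A * r ^ (2 * k)) * wellPoised r A e (r * Y) k -
      (1 - A * (r * Y)) * (1 - e * (r * Y)) *
        ∑ k ∈ range (m + 1), (1 - A * r ^ (2 * k)) * wellPoised r A e Y k =
      r * Y * (1 - A * (r * Y)) * (1 - A * r ^ m) ^ 2 * (e - r ^ m) /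
        (1 - A * Y * r ^ (m + 1)) * wellPoised r A e Y m := by
  induction m with
  | zero =>
    have h2 := hY 0
    simp only [wellPoised, sum_range_succ, prod_range_zero, sum_range_zero, pow_zero, zero_add,
      pow_one, mul_zero] at h2 ⊢
    rw [div_mul_eq_mul_div, eq_div_iff h2]
    ring
  | succ k ih =>
    rw [sum_range_succ, sum_range_succ _ (k + 1), mul_add _ (Finset.sum _ _),
      mul_add _ (Finset.sum _ _), add_sub_add_comm, ih,
      wellPoised_mul_succ hr he hY,
      show wellPoised r A e Y (k + 1) = _ from prod_range_succ _ _, ← wellPoised]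
    have h0 := hr k
    have h1 := he k
    have h2 := hY k
    have h2' := hY (k + 1)
    rw [show r ^ (k + 2) = r ^ (k + 1 + 1) by ring]
    rw [show r ^ (2 * (k + 1)) = r ^ 2 * r ^ k * r ^ k by ring]
    rw [show r ^ (k + 1 + 1) = r ^ 2 * r ^ k by ring] at *
    rw [show r ^ (k + 1) = r * r ^ k by ring] at *
    clear ih hr he hY
    generalize r ^ k = x at *
    generalize wellPoised r A e Y k = w at *
    obtain ⟨B, hB⟩ : ∃ B, B = 1 - A * Y * (r ^ 2 * x) := ⟨_, rfl⟩
    obtain ⟨C, hC⟩ : ∃ C, C = 1 - A * Y * (r * x) := ⟨_, rfl⟩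
    obtain ⟨D, hD⟩ : ∃ D, D = 1 - A * e * (r * x) := ⟨_, rfl⟩
    rw [← hB] at h2' ⊢
    rw [← hC] at h2 ⊢
    rw [← hD] at h1 ⊢
    field_simp
    rw [hB, hD]
    ring

theorem wellPoised_eq_zero {N k : ℕ} (h : N < k) : wellPoised r A e (r ^ N) k = 0 :=
  prod_eq_zero (mem_range.2 h) (by rw [sub_self, mul_zero, zero_div])

/-- Terminating very-well-poised `₆φ₅` summation, with one numerator parameter equal to `A`. -/
theorem sum_wellPoised (hr : ∀ i : ℕ, 1 - r ^ (i + 1) ≠ 0)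
    (he : ∀ i : ℕ, 1 - A * e * r ^ (i + 1) ≠ 0) (hA : ∀ i : ℕ, 1 - A * r ^ (i + 1) ≠ 0)
    (N : ℕ) :
    ∑ k ∈ range (N + 1), (1 - A * r ^ (2 * k)) * wellPoised r A e (r ^ N) k =
      (1 - A) * ∏ j ∈ range N, (1 - A * r ^ (j + 1)) * (1 - e * r ^ (j + 1)) /
        ((1 - r ^ (j + 1)) * (1 - A * e * r ^ (j + 1))) := by
  induction N with
  | zero => simp [wellPoised]
  | succ N ih =>
    have hY : ∀ i : ℕ, 1 - A * r ^ N * r ^ (i + 1) ≠ 0 := fun i => by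
      rw [mul_assoc, ← pow_add, ← add_assoc]; exact hA _
    have h := sum_wellPoised_sub hr he hY (N + 1)
    rw [← pow_succ', sum_range_succ (fun k => _ * wellPoised r A e (r ^ N) k) (N + 1), ih,
      wellPoised_eq_zero (Nat.lt_succ_self N), mul_zero, mul_zero, add_zero, sub_eq_zero] at h
    rw [prod_range_succ, ← mul_assoc, ← mul_div_assoc,
      eq_div_iff (mul_ne_zero (hr N) (he N))]
    linear_combination h

end wellPoised

/-- The quotient `(q^e; q^4)_k / (q^4; q^4)_k`. -/
noncomputable def pochRatio {F : Type*} [Field F] (q : F) (e k : ℕ) : F :=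
  ∏ i ∈ range k, (1 - q ^ (4 * i + e)) / (1 - q ^ (4 * i + 4))

/-- The summand `[8k+1] (q; q^4)_k^4 / (q^4; q^4)_k^4 q^(2k)`. -/
noncomputable def summand {F : Type*} [Field F] (q : F) (k : ℕ) : F :=
  (1 - q ^ (8 * k + 1)) / (1 - q) * pochRatio q 1 k ^ 4 * q ^ (2 * k)

/-- Logarithmic derivative at `s = 0` of
`∏ i < k, ((1 - q^(4i+1))^2 + q^(4i+1) s) / ((1 - q^(4i+4))^2 + q^(4i+4) s)`. -/
noncomputable def logDerivSum {F : Type*} [Field F] (q : F) (k : ℕ) : F :=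
  ∑ i ∈ range k, (q ^ (4 * i + 1) / (1 - q ^ (4 * i + 1)) ^ 2 -
    q ^ (4 * i + 4) / (1 - q ^ (4 * i + 4)) ^ 2)

theorem pochRatio_succ {F : Type*} [Field F] (q : F) (e k : ℕ) :
    pochRatio q e (k + 1) =
      pochRatio q e k * ((1 - q ^ (4 * k + e)) / (1 - q ^ (4 * k + 4))) :=
  prod_range_succ _ _

theorem logDerivSum_succ {F : Type*} [Field F] (q : F) (k : ℕ) :
    logDerivSum q (k + 1) = logDerivSum q k +
      (q ^ (4 * k + 1) / (1 - q ^ (4 * k + 1)) ^ 2 -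
        q ^ (4 * k + 4) / (1 - q ^ (4 * k + 4)) ^ 2) :=
  sum_range_succ _ _

theorem sum_eq_zero_of_antisymm {F : Type*} [Field F] [CharZero F] {N : ℕ} {f : ℕ → F}
    (h : ∀ k ≤ N, f (N - k) = -f k) : ∑ k ∈ range (N + 1), f k = 0 := by
  have h1 := sum_range_reflect f (N + 1)
  rw [sum_congr rfl fun k hk => by
    rw [Nat.add_sub_cancel, h k (Nat.lt_succ_iff.1 (mem_range.1 hk))], sum_neg_distrib] at h1
  exact self_eq_neg.1 h1.symm

section rootOfUnity

variable {F : Type*} [Field F] {ζ : F} {d N : ℕ}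

theorem not_dvd_four_mul_add {e i : ℕ} (hd : d.Coprime 4) (hN : N < d) (hdN : d ∣ 4 * N + e)
    (hi : i < d) (hiN : i ≠ N) : ¬ d ∣ 4 * i + e := by
  intro h
  have h1 : 4 * i + e ≡ 4 * N + e [MOD d] :=
    ((Nat.modEq_zero_iff_dvd.2 h).trans (Nat.modEq_zero_iff_dvd.2 hdN).symm)
  have h2 : i ≡ N [MOD d] := (h1.add_right_cancel' e).cancel_left_of_coprime hd
  exact hiN (h2.eq_of_lt_of_lt hi hN)

theorem not_dvd_four_mul_add_four {i : ℕ} (hd : d.Coprime 4) (hi : i + 1 < d) :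
    ¬ d ∣ 4 * i + 4 := by
  intro h
  have h1 : d ∣ 4 * (i + 1) := by rwa [mul_add]
  exact Nat.not_dvd_of_pos_of_lt i.succ_pos hi (hd.dvd_of_dvd_mul_left h1)

theorem one_sub_pow_ne_zero (hζ : IsPrimitiveRoot ζ d) {m : ℕ} (h : ¬ d ∣ m) : 1 - ζ ^ m ≠ 0 := by
  rwa [sub_ne_zero, ne_comm, Ne, hζ.pow_eq_one_iff_dvd]

theorem pochRatio_eq_zero (hζ : IsPrimitiveRoot ζ d) {e k : ℕ} (hdN : d ∣ 4 * N + e)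
    (h : N < k) : pochRatio ζ e k = 0 :=
  prod_eq_zero (mem_range.2 h) (by rw [(hζ.pow_eq_one_iff_dvd _).2 hdN, sub_self, zero_div])

theorem pow_mul_pow_reflect (hζ : IsPrimitiveRoot ζ d) (hdN : d ∣ 4 * N + 1) {j : ℕ} (hj : j < N) :
    ζ ^ (4 * (N - 1 - j) + 1) * (ζ ^ 3 * ζ ^ (4 * j + 1)) = 1 ∧
      ζ ^ (4 * (N - 1 - j) + 4) * ζ ^ (4 * j + 1) = 1 := by
  rw [← pow_add, ← pow_add, ← pow_add,
    show 4 * (N - 1 - j) + 1 + (3 + (4 * j + 1)) = 4 * N + 1 by omega,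
    show 4 * (N - 1 - j) + 4 + (4 * j + 1) = 4 * N + 1 by omega]
  simp [(hζ.pow_eq_one_iff_dvd _).2 hdN]

variable (hζ : IsPrimitiveRoot ζ d) (hd : d.Coprime 4) (hN : N < d) (hdN : d ∣ 4 * N + 1)
include hζ hd hN hdN

theorem pochRatio_reflect {k : ℕ} (hk : k ≤ N) :
    pochRatio ζ 1 (N - k) = pochRatio ζ 1 k * pochRatio ζ 1 N * ζ ^ (3 * k) := by
  induction k with
  | zero => simp [pochRatio]
  | succ k ih =>
    have h := ih (by omega)
    rw [show N - k = (N - 1 - k) + 1 by omega, pochRatio_succ] at h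
    rw [show N - (k + 1) = N - 1 - k by omega, pochRatio_succ]
    obtain ⟨h1, h2⟩ := pow_mul_pow_reflect hζ hdN (j := k) (by omega)
    have h3 := one_sub_pow_ne_zero hζ
      (not_dvd_four_mul_add hd hN hdN (i := k) (by omega) (by omega))
    have h4 := one_sub_pow_ne_zero hζ (not_dvd_four_mul_add_four hd (i := k) (by omega))
    have h5 := one_sub_pow_ne_zero hζ
      (not_dvd_four_mul_add hd hN hdN (i := N - 1 - k) (by omega) (by omega))
    have h6 := one_sub_pow_ne_zero hζ (not_dvd_four_mul_add_four hd (i := N - 1 - k) (by omega))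
    have h7 : (1 - ζ ^ (4 * (N - 1 - k) + 1)) / (1 - ζ ^ (4 * (N - 1 - k) + 4)) * ζ ^ 3 *
        ((1 - ζ ^ (4 * k + 1)) / (1 - ζ ^ (4 * k + 4))) = 1 := by
      rw [show ζ ^ (4 * k + 4) = ζ ^ 3 * ζ ^ (4 * k + 1) by ring] at *
      generalize ζ ^ (4 * k + 1) = x at *
      generalize ζ ^ (4 * (N - 1 - k) + 1) = y at *
      generalize ζ ^ (4 * (N - 1 - k) + 4) = z at *
      generalize ζ ^ 3 = w at *
      field_simp
      linear_combination h1 - w * h2 - z * h1 + y * w * h2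
    rw [show 3 * (k + 1) = 3 * k + 3 by ring, pow_add ζ (3 * k)]
    generalize (1 - ζ ^ (4 * (N - 1 - k) + 1)) / (1 - ζ ^ (4 * (N - 1 - k) + 4)) = a at *
    generalize (1 - ζ ^ (4 * k + 1)) / (1 - ζ ^ (4 * k + 4)) = b at *
    linear_combination (ζ ^ 3 * b) * h - pochRatio ζ 1 (N - 1 - k) * h7

theorem logDerivSum_reflect_aux {k : ℕ} (hk : k ≤ N) :
    logDerivSum ζ (N - k) = logDerivSum ζ N + logDerivSum ζ k := by
  induction k with
  | zero => simp [logDerivSum]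
  | succ k ih =>
    have h := ih (by omega)
    rw [show N - k = (N - 1 - k) + 1 by omega, logDerivSum_succ] at h
    rw [show N - (k + 1) = N - 1 - k by omega, logDerivSum_succ]
    obtain ⟨h1, h2⟩ := pow_mul_pow_reflect hζ hdN (j := k) (by omega)
    have h3 := one_sub_pow_ne_zero hζ
      (not_dvd_four_mul_add hd hN hdN (i := k) (by omega) (by omega))
    have h4 := one_sub_pow_ne_zero hζ (not_dvd_four_mul_add_four hd (i := k) (by omega))
    have h5 := one_sub_pow_ne_zero hζ
      (not_dvd_four_mul_add hd hN hdN (i := N - 1 - k) (by omega) (by omega))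
    have h6 := one_sub_pow_ne_zero hζ (not_dvd_four_mul_add_four hd (i := N - 1 - k) (by omega))
    have key : ∀ x y : F, y * x = 1 → 1 - x ≠ 0 → 1 - y ≠ 0 →
        y / (1 - y) ^ 2 = x / (1 - x) ^ 2 := by
      intro x y hxy hx hy
      rw [div_eq_div_iff (pow_ne_zero 2 hy) (pow_ne_zero 2 hx)]
      linear_combination (x - y) * hxy
    rw [key _ _ h2 h3 h6,
      key (ζ ^ (4 * k + 4)) _ (by rw [← h1]; ring) h4 h5] at h
    linear_combination h

theorem logDerivSum_reflect [CharZero F] {k : ℕ} (hk : k ≤ N) :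
    logDerivSum ζ (N - k) = logDerivSum ζ k := by
  have h := logDerivSum_reflect_aux hζ hd hN hdN le_rfl
  rw [Nat.sub_self, show logDerivSum ζ 0 = 0 from rfl, eq_comm, add_self_eq_zero] at h
  rw [logDerivSum_reflect_aux hζ hd hN hdN hk, h, zero_add]

theorem summand_reflect {k : ℕ} (hk : k ≤ N) : summand ζ (N - k) = -summand ζ k := by
  have hsq := pochRatio_reflect hζ hd hN hdN le_rfl
  rw [Nat.sub_self, show pochRatio ζ 1 0 = 1 from rfl] at hsq
  have h1 : ζ ^ (4 * N + 1) = 1 := (hζ.pow_eq_one_iff_dvd _).2 hdN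
  have hζ0 : ζ ≠ 0 := hζ.ne_zero (by omega)
  have h2 : pochRatio ζ 1 N ^ 4 * ζ ^ (6 * N) = 1 := by
    rw [show ζ ^ (6 * N) = (ζ ^ (3 * N)) ^ 2 by ring]
    linear_combination (-1 - pochRatio ζ 1 N * pochRatio ζ 1 N * ζ ^ (3 * N)) * hsq
  have h3 : ζ ^ (8 * (N - k) + 1) * ζ ^ (8 * k + 1) = 1 := by
    rw [← pow_add, show 8 * (N - k) + 1 + (8 * k + 1) = (4 * N + 1) * 2 by omega, pow_mul, h1,
      one_pow]
  have h4 : ζ ^ (2 * (N - k)) * ζ ^ (2 * k) = ζ ^ (2 * N) := by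
    rw [← pow_add]; congr 1; omega
  have h5 : (1 - ζ ^ (8 * (N - k) + 1)) * ζ ^ (8 * k + 1) = -(1 - ζ ^ (8 * k + 1)) := by
    linear_combination -h3
  have h6 : (ζ ^ (3 * k)) ^ 4 * ζ ^ (2 * N) = ζ ^ (6 * N) * ζ ^ (8 * k + 1) * (ζ ^ (2 * k)) ^ 2 := by
    have : ζ ^ (6 * N) * ζ ^ (8 * k + 1) * (ζ ^ (2 * k)) ^ 2 =
      ζ ^ (4 * N + 1) * ((ζ ^ (3 * k)) ^ 4 * ζ ^ (2 * N)) := by ring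
    rw [this, h1, one_mul]
  rw [summand, summand, pochRatio_reflect hζ hd hN hdN hk]
  have hz : ζ ^ (8 * k + 1) * ζ ^ (2 * k) * ζ ^ (6 * N) ≠ 0 := by positivity
  apply mul_right_cancel₀ hz
  generalize pochRatio ζ 1 k = a at *
  generalize pochRatio ζ 1 N = b at *
  simp only [div_eq_mul_inv]
  generalize (1 - ζ)⁻¹ = c at *
  generalize ζ ^ (8 * k + 1) = x at *
  generalize ζ ^ (8 * (N - k) + 1) = x' at *
  generalize ζ ^ (2 * k) = y at *
  generalize ζ ^ (2 * (N - k)) = y' at *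
  generalize ζ ^ (2 * N) = z at *
  generalize ζ ^ (3 * k) = w at *
  generalize ζ ^ (6 * N) = v at *
  calc (1 - x') * c * (a * b * w) ^ 4 * y' * (x * y * v)
      = ((1 - x') * x) * (b ^ 4 * v) * (y' * y) * w ^ 4 * c * a ^ 4 := by ring
    _ = -(1 - x) * (w ^ 4 * z) * c * a ^ 4 := by rw [h5, h2, h4]; ring
    _ = -((1 - x) * c * a ^ 4 * y) * (x * y * v) := by rw [h6]; ring

theorem sum_summand_eq_zero [CharZero F] : ∑ k ∈ range (N + 1), summand ζ k = 0 :=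
  sum_eq_zero_of_antisymm fun _ => summand_reflect hζ hd hN hdN

theorem sum_summand_mul_logDerivSum_eq_zero [CharZero F] :
    ∑ k ∈ range (N + 1), summand ζ k * logDerivSum ζ k = 0 :=
  sum_eq_zero_of_antisymm fun _ hk => by
    rw [summand_reflect hζ hd hN hdN hk, logDerivSum_reflect hζ hd hN hdN hk, neg_mul]

theorem sum_range_summand_eq_zero [CharZero F] : ∑ k ∈ range d, summand ζ k = 0 := by
  rw [← sum_summand_eq_zero hζ hd hN hdN, eq_comm]
  refine sum_subset (range_subset_range.2 hN) fun k _ hk => ?_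
  rw [summand, pochRatio_eq_zero hζ hdN (by simpa using hk)]
  simp

end rootOfUnity

/-- The deformation `∏ i < k, ((1 - q^(4i+1))^2 + q^(4i+1) s) / ((1 - q^(4i+4))^2 + q^(4i+4) s)`
of `(q; q^4)_k^2 / (q^4; q^4)_k^2`. -/
noncomputable def deformedRatio {F : Type*} [Field F] (q s : F) (k : ℕ) : F :=
  ∏ i ∈ range k, ((1 - q ^ (4 * i + 1)) ^ 2 + q ^ (4 * i + 1) * s) /
    ((1 - q ^ (4 * i + 4)) ^ 2 + q ^ (4 * i + 4) * s)

section specialization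

variable {F : Type*} [Field F] {q : F}

theorem pow_ne_pow_of_one_sub_ne_zero (hq0 : q ≠ 0) (hq : ∀ m : ℕ, 0 < m → 1 - q ^ m ≠ 0)
    {a b : ℕ} (hab : a ≠ b) : q ^ a ≠ q ^ b := by
  wlog h : a < b generalizing a b
  · exact (this hab.symm (by omega)).symm
  intro h1
  apply hq (b - a) (by omega)
  apply mul_left_cancel₀ (pow_ne_zero a hq0)
  rw [mul_sub, ← pow_add, show a + (b - a) = b by omega, mul_one, mul_zero, h1, sub_self]

theorem wellPoised_eq_deformedRatio (hq0 : q ≠ 0) (N k : ℕ) :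
    wellPoised (q ^ 4) q (q ^ (4 * N + 2))⁻¹ ((q ^ 4) ^ N) k =
      q ^ (2 * k) * pochRatio q 1 k ^ 2 *
        deformedRatio q (-(1 - q ^ (4 * N + 1)) ^ 2 / q ^ (4 * N + 1)) k := by
  rw [wellPoised, pochRatio, deformedRatio, ← prod_pow, pow_mul, ← card_range k, ← prod_const,
    card_range, ← prod_mul_distrib, ← prod_mul_distrib]
  refine prod_congr rfl fun i _ => ?_
  rw [div_pow, mul_div_assoc' (q ^ 2), div_mul_div_comm]
  rw [show (q ^ 4) ^ (i + 1) = q ^ 4 * q ^ (4 * i) by ring,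
    show (q ^ 4) ^ i = q ^ (4 * i) by ring, show (q ^ 4) ^ N = q ^ (4 * N) by ring,
    pow_add q (4 * N) 2, pow_add q (4 * N) 1, pow_add q (4 * i) 1, pow_add q (4 * i) 4, pow_one]
  have hu : q ^ (4 * N) ≠ 0 := pow_ne_zero _ hq0
  generalize q ^ (4 * i) = x
  generalize q ^ (4 * N) = u at *
  congr 1
  · field_simp
    ring
  · rw [mul_assoc]
    congr 1
    · ring
    · field_simp
      ring

theorem prod_wellPoised_closed_form (hq0 : q ≠ 0) (hq : ∀ m : ℕ, 0 < m → 1 - q ^ m ≠ 0) (N : ℕ) :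
    (1 - q) * ∏ j ∈ range N, (1 - q * (q ^ 4) ^ (j + 1)) *
        (1 - (q ^ (4 * N + 2))⁻¹ * (q ^ 4) ^ (j + 1)) /
        ((1 - (q ^ 4) ^ (j + 1)) * (1 - q * (q ^ (4 * N + 2))⁻¹ * (q ^ 4) ^ (j + 1))) =
      pochRatio q 2 N * (1 - q ^ (4 * N + 1)) * (q ^ N)⁻¹ := by
  have hreflect : ∏ j ∈ range N, (1 - (q ^ (4 * N + 2))⁻¹ * (q ^ 4) ^ (j + 1)) /
      (1 - q * (q ^ (4 * N + 2))⁻¹ * (q ^ 4) ^ (j + 1)) =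
      ∏ j ∈ range N, q⁻¹ * ((1 - q ^ (4 * j + 2)) / (1 - q ^ (4 * j + 1))) := by
    rw [← prod_range_reflect]
    refine prod_congr rfl fun j hj => ?_
    have hj := mem_range.1 hj
    have h1 : (q ^ (4 * N + 2))⁻¹ * (q ^ 4) ^ (N - 1 - j + 1) = (q ^ (4 * j + 2))⁻¹ := by
      rw [inv_mul_eq_div, div_eq_iff (pow_ne_zero _ hq0), eq_inv_mul_iff_mul_eq₀
        (pow_ne_zero _ hq0), ← pow_mul, ← pow_add]
      congr 1
      omega
    rw [mul_assoc, h1]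
    have h2 := hq (4 * j + 1) (by omega)
    have h3 : (1 - q * (q ^ (4 * j + 2))⁻¹) = -(q ^ (4 * j + 1))⁻¹ * (1 - q ^ (4 * j + 1)) := by
      rw [pow_succ q (4 * j + 1)]
      field_simp
      ring
    have h4 : (1 - (q ^ (4 * j + 2))⁻¹) =
        -(q ^ (4 * j + 1))⁻¹ * q⁻¹ * (1 - q ^ (4 * j + 2)) := by
      rw [pow_succ q (4 * j + 1)]
      field_simp
      ring
    rw [h3, h4]
    field_simp
  have hshift : (1 - q) * ∏ j ∈ range N, (1 - q * (q ^ 4) ^ (j + 1)) =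
      (∏ j ∈ range N, (1 - q ^ (4 * j + 1))) * (1 - q ^ (4 * N + 1)) := by
    rw [← prod_range_succ, prod_range_succ', mul_comm]
    congr 1
    · exact prod_congr rfl fun j _ => by ring
    · ring
  have hne : ∏ j ∈ range N, (1 - q ^ (4 * j + 1)) ≠ 0 :=
    prod_ne_zero_iff.2 fun j _ => hq _ (by omega)
  simp_rw [mul_div_mul_comm]
  rw [prod_mul_distrib, hreflect, prod_mul_distrib, prod_const, card_range, prod_div_distrib,
    prod_div_distrib, ← mul_assoc, ← mul_div_assoc, hshift, pochRatio, prod_div_distrib, inv_pow,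
    show ∏ j ∈ range N, (1 - (q ^ 4) ^ (j + 1)) = ∏ j ∈ range N, (1 - q ^ (4 * j + 4)) from
      prod_congr rfl fun j _ => by ring]
  field_simp

theorem sum_deformedRatio (hq0 : q ≠ 0) (hq : ∀ m : ℕ, 0 < m → 1 - q ^ m ≠ 0) (N : ℕ) :
    ∑ k ∈ range (N + 1), (1 - q ^ (8 * k + 1)) / (1 - q) * pochRatio q 1 k ^ 2 * q ^ (2 * k) *
        deformedRatio q (-(1 - q ^ (4 * N + 1)) ^ 2 / q ^ (4 * N + 1)) k =
      pochRatio q 2 N * ((1 - q ^ (4 * N + 1)) / (1 - q)) * (q ^ N)⁻¹ := by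
  have h := sum_wellPoised (r := q ^ 4) (A := q) (e := (q ^ (4 * N + 2))⁻¹)
    (fun i => by rw [← pow_mul]; exact hq _ (by omega))
    (fun i => by
      rw [pow_succ q (4 * N + 1), mul_inv_rev, mul_inv_cancel_left₀ hq0, sub_ne_zero, ne_comm, Ne,
        inv_mul_eq_one₀ (pow_ne_zero _ hq0), ← pow_mul]
      exact pow_ne_pow_of_one_sub_ne_zero hq0 hq (by omega))
    (fun i => by rw [← pow_mul, ← pow_succ']; exact hq _ (by omega)) N
  rw [prod_wellPoised_closed_form hq0 hq] at h
  calc _ = (∑ k ∈ range (N + 1), (1 - q * (q ^ 4) ^ (2 * k)) *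
        wellPoised (q ^ 4) q (q ^ (4 * N + 2))⁻¹ ((q ^ 4) ^ N) k) / (1 - q) := by
        rw [sum_div]
        refine sum_congr rfl fun k _ => ?_
        rw [wellPoised_eq_deformedRatio hq0, show q * (q ^ 4) ^ (2 * k) = q ^ (8 * k + 1) by ring]
        ring
    _ = _ := by rw [h]; ring

end specialization

theorem one_sub_ratFuncX_pow_ne_zero {m : ℕ} (hm : 0 < m) :
    1 - (RatFunc.X : RatFunc ℚ) ^ m ≠ 0 := by
  have h : algebraMap ℚ[X] (RatFunc ℚ) (X ^ m - 1) ≠ 0 := by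
    rw [Ne, map_eq_zero_iff _ (RatFunc.algebraMap_injective ℚ)]
    exact X_pow_sub_C_ne_zero hm 1
  rw [map_sub, map_pow, RatFunc.algebraMap_X, map_one] at h
  rwa [← neg_sub, neg_ne_zero]

section values

variable {ζ : ℂ} {d N e : ℕ}

theorem hasValue_one_sub_pow_div (hζ : IsPrimitiveRoot ζ d) (hd : 0 < d) {a b : ℕ} (ha : d ∣ a)
    (hb : d ∣ b) (hb0 : b ≠ 0) :
    ∃ y, HasValue ζ ((1 - RatFunc.X ^ a) / (1 - RatFunc.X ^ b)) y := by
  obtain ⟨a, rfl⟩ := ha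
  obtain ⟨b, rfl⟩ := hb
  have hgeom : ∀ m, HasValue ζ (∑ i ∈ range m, (RatFunc.X ^ d) ^ i) m := fun m => by
    have h := HasValue.sum (s := range m) fun i _ => ((HasValue.ratFuncX ζ).pow d).pow i
    simpa [hζ.pow_eq_one] using h
  have hX := one_sub_ratFuncX_pow_ne_zero hd
  have hb : (b : ℂ) ≠ 0 := by
    rintro h
    simp_all
  refine ⟨_, ((hgeom a).div (hgeom b) hb).congr_left ?_⟩
  rw [pow_mul, pow_mul, ← mul_neg_geom_sum _ a, ← mul_neg_geom_sum _ b, mul_div_mul_left _ _ hX]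

theorem pochRatio_add {F : Type*} [Field F] (q : F) (e m r : ℕ) :
    pochRatio q e (m + r) = pochRatio q e m *
      ∏ i ∈ range r, (1 - q ^ (4 * (m + i) + e)) / (1 - q ^ (4 * (m + i) + 4)) :=
  prod_range_add _ _ _

theorem HasValue.pow_mul_add (hζ : IsPrimitiveRoot ζ d) (j i e : ℕ) :
    HasValue ζ (1 - RatFunc.X ^ (4 * (d * j + i) + e)) (1 - ζ ^ (4 * i + e)) := by
  refine (HasValue.one_sub_X_pow ζ _).congr_right ?_
  rw [show 4 * (d * j + i) + e = d * (4 * j) + (4 * i + e) by ring, pow_add, pow_mul,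
    hζ.pow_eq_one, one_pow, one_mul]

theorem hasValue_pochRatio_mul (hζ : IsPrimitiveRoot ζ d) (hd : d.Coprime 4) (hN : N < d)
    (hdN : d ∣ 4 * N + e) (j : ℕ) : ∃ y, HasValue ζ (pochRatio RatFunc.X e (d * j)) y := by
  induction j with
  | zero => exact ⟨1, HasValue.one ζ⟩
  | succ j ih =>
    obtain ⟨y, hy⟩ := ih
    rw [Nat.mul_succ, pochRatio_add]
    obtain ⟨m, rfl⟩ : ∃ m, d = m + 1 := ⟨d - 1, by omega⟩
    obtain ⟨z, hz⟩ := hasValue_one_sub_pow_div hζ (by omega)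
      (a := 4 * ((m + 1) * j + N) + e) (b := 4 * ((m + 1) * j + m) + 4)
      (by rw [show 4 * ((m + 1) * j + N) + e = (m + 1) * (4 * j) + (4 * N + e) by ring]
          exact (Nat.dvd_mul_right _ _).add hdN)
      ⟨4 * (j + 1), by ring⟩ (by omega)
    have hnum := HasValue.prod (s := (range (m + 1)).erase N)
      fun i _ => HasValue.pow_mul_add hζ j i e
    have hden := HasValue.prod (s := range m) fun i _ => HasValue.pow_mul_add hζ j i 4
    refine ⟨_, hy.mul ((hz.mul (hnum.div hden ?_)).congr_left ?_)⟩
    · exact prod_ne_zero_iff.2 fun i hi => one_sub_pow_ne_zero hζ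
        (not_dvd_four_mul_add_four hd (by simpa using hi))
    · rw [prod_div_distrib, prod_range_succ (fun i => 1 - RatFunc.X ^ (_ + 4)),
        ← mul_prod_erase (range (m + 1)) _ (mem_range.2 hN), mul_comm (∏ i ∈ range m, _),
        mul_div_mul_comm]

theorem hasValue_pochRatio (hζ : IsPrimitiveRoot ζ d) (hd : d.Coprime 4) (hN : N < d)
    (hdN : d ∣ 4 * N + e) (j : ℕ) :
    ∃ y, ∀ r < d, HasValue ζ (pochRatio RatFunc.X e (d * j + r)) (y * pochRatio ζ e r) := by
  obtain ⟨y, hy⟩ := hasValue_pochRatio_mul hζ hd hN hdN j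
  refine ⟨y, fun r hr => ?_⟩
  rw [pochRatio_add]
  refine hy.mul (HasValue.prod fun i hi => ?_)
  have hi := mem_range.1 hi
  exact (HasValue.pow_mul_add hζ j i e).div (HasValue.pow_mul_add hζ j i 4)
    (one_sub_pow_ne_zero hζ (not_dvd_four_mul_add_four hd (by omega)))

theorem one_sub_ne_zero_of_isPrimitiveRoot (hζ : IsPrimitiveRoot ζ d) (hd1 : 1 < d) :
    1 - ζ ≠ 0 := by
  simpa using one_sub_pow_ne_zero hζ (m := 1) (by rw [Nat.dvd_one]; omega)

theorem hasValue_qInt (hζ : IsPrimitiveRoot ζ d) (hd1 : 1 < d) (m : ℕ) :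
    HasValue ζ ((1 - RatFunc.X ^ m) / (1 - RatFunc.X)) ((1 - ζ ^ m) / (1 - ζ)) :=
  (HasValue.one_sub_X_pow ζ m).div ((HasValue.one ζ).sub (HasValue.ratFuncX ζ))
    (one_sub_ne_zero_of_isPrimitiveRoot hζ hd1)

theorem hasValue_sum_summand (hζ : IsPrimitiveRoot ζ d) (hd : d.Coprime 4) (hd1 : 1 < d)
    (hN : N < d) (hdN : d ∣ 4 * N + 1) (m : ℕ) :
    HasValue ζ (∑ k ∈ range (d * m), summand RatFunc.X k) 0 := by
  induction m with
  | zero => exact HasValue.zero ζ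
  | succ j ih =>
    obtain ⟨y, hy⟩ := hasValue_pochRatio hζ hd hN hdN j
    rw [Nat.mul_succ, sum_range_add, ← add_zero (0 : ℂ)]
    refine ih.add ?_
    rw [← mul_zero (y ^ 4), ← sum_range_summand_eq_zero hζ hd hN hdN, mul_sum]
    refine HasValue.sum fun r hr => ?_
    have h := ((hasValue_qInt hζ hd1 (8 * (d * j + r) + 1)).mul
      ((hy r (mem_range.1 hr)).pow 4)).mul ((HasValue.ratFuncX ζ).pow (2 * (d * j + r)))
    refine h.congr_right ?_
    rw [show 8 * (d * j + r) + 1 = d * (8 * j) + (8 * r + 1) by ring,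
      show 2 * (d * j + r) = d * (2 * j) + 2 * r by ring, pow_add ζ, pow_mul ζ,
      pow_add ζ (d * _) (2 * r), pow_mul ζ, hζ.pow_eq_one, summand]
    ring

theorem hasValue_closed_form (hζ : IsPrimitiveRoot ζ d) (hd : d.Coprime 4) (hd1 : 1 < d)
    (hdN : d ∣ 4 * N + 1) :
    HasValue ζ (pochRatio RatFunc.X 2 N * ((1 - RatFunc.X ^ (4 * N + 1)) / (1 - RatFunc.X)) *
      (RatFunc.X ^ N)⁻¹) 0 := by
  have hmod : d ∣ 4 * (2 * N % d) + 2 := by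
    rw [← Nat.modEq_zero_iff_dvd]
    refine ((((Nat.mod_modEq (2 * N) d).mul_left 4).add_right 2).trans ?_)
    rw [Nat.modEq_zero_iff_dvd, show 4 * (2 * N) + 2 = (4 * N + 1) * 2 by ring]
    exact hdN.mul_right 2
  obtain ⟨y, hy⟩ := hasValue_pochRatio hζ hd (Nat.mod_lt _ (by omega)) hmod (N / d)
  have h1 := hy (N % d) (Nat.mod_lt _ (by omega))
  rw [Nat.div_add_mod] at h1
  have hζ0 : ζ ≠ 0 := hζ.ne_zero (by omega)
  refine ((h1.mul (hasValue_qInt hζ hd1 (4 * N + 1))).mul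
    (((HasValue.ratFuncX ζ).pow N).inv (pow_ne_zero N hζ0))).congr_right ?_
  rw [(hζ.pow_eq_one_iff_dvd _).2 hdN]
  simp

end values

section primitive

variable {ζ : ℂ} {N : ℕ}

theorem deformed_factor_eq {F : Type*} [Field F] {a b s : F} (ha : 1 - a ≠ 0) (hb : 1 - b ≠ 0)
    (hs : 1 + s * (b / (1 - b) ^ 2) ≠ 0) :
    ((1 - a) ^ 2 + a * s) / ((1 - b) ^ 2 + b * s) =
      ((1 - a) / (1 - b)) ^ 2 * (1 + s * (a / (1 - a) ^ 2 - b / (1 - b) ^ 2)) +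
        s ^ 2 * -(((1 - a) / (1 - b)) ^ 2 * (b / (1 - b) ^ 2) *
          (a / (1 - a) ^ 2 - b / (1 - b) ^ 2) / (1 + s * (b / (1 - b) ^ 2))) := by
  have h1 : (1 - b) ^ 2 + b * s = (1 - b) ^ 2 * (1 + s * (b / (1 - b) ^ 2)) := by
    field_simp
  have h2 : (1 - a) ^ 2 + a * s = (1 - a) ^ 2 * (1 + s * (a / (1 - a) ^ 2)) := by
    field_simp
  rw [h1, h2, mul_div_mul_comm, ← div_pow]
  generalize a / (1 - a) ^ 2 = α at *
  generalize b / (1 - b) ^ 2 = β at *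
  generalize (1 - a) / (1 - b) = c at *
  field_simp
  ring

variable (hζ : IsPrimitiveRoot ζ (4 * N + 1))
include hζ

theorem one_sub_pow_ne_zero_of_lt {i : ℕ} (hi : i < N) : 1 - ζ ^ (4 * i + 1) ≠ 0 :=
  one_sub_pow_ne_zero hζ (Nat.not_dvd_of_pos_of_lt (by omega) (by omega))

theorem one_sub_pow_four_ne_zero {i : ℕ} (hi : i < 4 * N) : 1 - ζ ^ (4 * i + 4) ≠ 0 :=
  one_sub_pow_ne_zero hζ (not_dvd_four_mul_add_four (by norm_num) (by omega))

theorem hasValue_pochRatio_of_le {k : ℕ} (hk : k ≤ 4 * N) :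
    HasValue ζ (pochRatio RatFunc.X 1 k) (pochRatio ζ 1 k) :=
  HasValue.prod fun i hi => (HasValue.one_sub_X_pow ζ _).div (HasValue.one_sub_X_pow ζ _)
    (one_sub_pow_four_ne_zero hζ (by have := mem_range.1 hi; omega))

theorem hasValue_logDerivSum {k : ℕ} (hk : k ≤ N) :
    HasValue ζ (logDerivSum RatFunc.X k) (logDerivSum ζ k) :=
  HasValue.sum fun i hi => by
    have hi := mem_range.1 hi
    exact (((HasValue.ratFuncX ζ).pow _).div ((HasValue.one_sub_X_pow ζ _).pow 2)
      (pow_ne_zero 2 (one_sub_pow_ne_zero_of_lt hζ (by omega)))).sub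
      (((HasValue.ratFuncX ζ).pow _).div ((HasValue.one_sub_X_pow ζ _).pow 2)
      (pow_ne_zero 2 (one_sub_pow_four_ne_zero hζ (by omega))))

theorem hasValue_summand {k : ℕ} (hN : 0 < N) (hk : k ≤ 4 * N) :
    HasValue ζ (summand RatFunc.X k) (summand ζ k) :=
  ((hasValue_qInt hζ (by omega) _).mul ((hasValue_pochRatio_of_le hζ hk).pow 4)).mul
    ((HasValue.ratFuncX ζ).pow _)

theorem deformedRatio_expansion {s : RatFunc ℚ} (hs : HasValue ζ s 0) {k : ℕ} (hk : k ≤ N) :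
    ∃ E y, HasValue ζ E y ∧ deformedRatio RatFunc.X s k =
      pochRatio RatFunc.X 1 k ^ 2 * (1 + s * logDerivSum RatFunc.X k) + s ^ 2 * E := by
  induction k with
  | zero => exact ⟨0, 0, HasValue.zero ζ, by simp [deformedRatio, pochRatio, logDerivSum]⟩
  | succ k ih =>
    obtain ⟨E, y, hE, hR⟩ := ih (by omega)
    have ha := one_sub_pow_ne_zero_of_lt hζ (i := k) (by omega)
    have hb := one_sub_pow_four_ne_zero hζ (i := k) (by omega)
    have hXa := HasValue.one_sub_X_pow ζ (4 * k + 1)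
    have hXb := HasValue.one_sub_X_pow ζ (4 * k + 4)
    have hα := ((HasValue.ratFuncX ζ).pow (4 * k + 1)).div (hXa.pow 2) (pow_ne_zero 2 ha)
    have hβ := ((HasValue.ratFuncX ζ).pow (4 * k + 4)).div (hXb.pow 2) (pow_ne_zero 2 hb)
    have hc := (hXa.div hXb hb).pow 2
    have hsβ := (HasValue.one ζ).add (hs.mul hβ)
    rw [zero_mul, add_zero] at hsβ
    have hE' := (((hc.mul hβ).mul (hα.sub hβ)).div hsβ one_ne_zero).neg
    have hfactor := deformed_factor_eq (hXa.ne_zero ha) (hXb.ne_zero hb)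
      (hsβ.ne_zero one_ne_zero)
    have hP := (hasValue_pochRatio_of_le hζ (k := k) (by omega)).pow 2
    have hL := hasValue_logDerivSum hζ (k := k) (by omega)
    have hρ := (hc.mul ((HasValue.one ζ).add (hs.mul (hα.sub hβ)))).add ((hs.pow 2).mul hE')
    refine ⟨_, _, (((hP.mul hc).mul hL).mul (hα.sub hβ)).add ((hE.mul hρ).add
      ((hP.mul ((HasValue.one ζ).add (hs.mul hL))).mul hE')), ?_⟩
    rw [show deformedRatio RatFunc.X s (k + 1) = _ from prod_range_succ _ _, ← deformedRatio,
      hR, hfactor, pochRatio_succ, logDerivSum_succ]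
    ring

theorem exists_pochRatio_eq_one_sub_pow_mul {k : ℕ} (hNk : N < k) (hk : k ≤ 4 * N) :
    ∃ z y, HasValue ζ z y ∧
      pochRatio RatFunc.X 1 k = (1 - RatFunc.X ^ (4 * N + 1)) * z := by
  have h := (HasValue.prod (s := (range k).erase N) fun i hi =>
    (HasValue.one_sub_X_pow ζ (4 * i + 1)).div (HasValue.one_sub_X_pow ζ (4 * i + 4))
      (one_sub_pow_four_ne_zero hζ (by have := mem_range.1 (mem_of_mem_erase hi); omega)))
  refine ⟨_, _, h.div (HasValue.one_sub_X_pow ζ (4 * N + 4))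
    (one_sub_pow_four_ne_zero hζ (by omega)), ?_⟩
  rw [pochRatio, ← mul_prod_erase (range k) _ (mem_range.2 hNk)]
  ring

theorem exists_difference_eq_cyclotomic_pow_mul (hN : 0 < N) :
    ∃ z y, HasValue ζ z y ∧
      (∑ k ∈ range (4 * N + 1), summand RatFunc.X k) -
        pochRatio RatFunc.X 2 N * ((1 - RatFunc.X ^ (4 * N + 1)) / (1 - RatFunc.X)) *
          (RatFunc.X ^ N)⁻¹ =
      algebraMap ℚ[X] (RatFunc ℚ) (cyclotomic (4 * N + 1) ℚ) ^ 3 * z := by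
  set Φ := algebraMap ℚ[X] (RatFunc ℚ) (cyclotomic (4 * N + 1) ℚ)
  have hζ0 : ζ ≠ 0 := hζ.ne_zero (by omega)
  obtain ⟨u, yu, hu, huΦ⟩ := ((HasValue.one_sub_X_pow ζ (4 * N + 1)).congr_right
    (by rw [hζ.pow_eq_one, sub_self])).exists_cyclotomic_mul (by omega) hζ
  obtain ⟨v, yv, hv, hvΦ⟩ := (HasValue.sum (s := range (N + 1)) fun k hk =>
    (hasValue_summand hζ (k := k) hN (by have := mem_range.1 hk; omega)).mul
      (hasValue_logDerivSum hζ (Nat.lt_succ_iff.1 (mem_range.1 hk)))).congr_right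
    (sum_summand_mul_logDerivSum_eq_zero hζ (by norm_num) (by omega) dvd_rfl)
    |>.exists_cyclotomic_mul (by omega) hζ
  have hw := (hu.pow 2).neg.div ((HasValue.ratFuncX ζ).pow (4 * N + 1)) (pow_ne_zero _ hζ0)
  set w := -u ^ 2 / RatFunc.X ^ (4 * N + 1)
  have hsw : -(1 - (RatFunc.X : RatFunc ℚ) ^ (4 * N + 1)) ^ 2 / RatFunc.X ^ (4 * N + 1) =
      Φ ^ 2 * w := by
    rw [huΦ]; ring
  have hΦ : HasValue ζ Φ 0 := (HasValue.ofPolynomial ζ _).congr_right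
    (by rw [cyclotomic_eq_minpoly_rat hζ (by omega), minpoly.aeval])
  have hs : HasValue ζ (Φ ^ 2 * w) 0 :=
    ((hΦ.pow 2).mul hw).congr_right (by rw [zero_pow two_ne_zero, zero_mul])
  have hexp : ∀ k, ∃ E y, k ≤ N → HasValue ζ E y ∧ deformedRatio RatFunc.X (Φ ^ 2 * w) k =
      pochRatio RatFunc.X 1 k ^ 2 * (1 + Φ ^ 2 * w * logDerivSum RatFunc.X k) +
        (Φ ^ 2 * w) ^ 2 * E := fun k => by
    by_cases hk : k ≤ N
    · obtain ⟨E, y, h⟩ := deformedRatio_expansion hζ hs hk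
      exact ⟨E, y, fun _ => h⟩
    · exact ⟨0, 0, fun h => absurd h hk⟩
  choose E yE hE using hexp
  have htail : ∀ i, ∃ z y, i < 3 * N → HasValue ζ z y ∧
      summand RatFunc.X (N + 1 + i) = Φ ^ 4 * z := fun i => by
    by_cases hi : i < 3 * N
    · obtain ⟨z, y, hz, h⟩ := exists_pochRatio_eq_one_sub_pow_mul hζ
        (k := N + 1 + i) (by omega) (by omega)
      refine ⟨_, _, fun _ => ⟨((hasValue_qInt hζ (by omega) (8 * (N + 1 + i) + 1)).mul
        ((hu.mul hz).pow 4)).mul ((HasValue.ratFuncX ζ).pow (2 * (N + 1 + i))), ?_⟩⟩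
      rw [summand, h, huΦ]
      ring
    · exact ⟨0, 0, fun h => absurd h hi⟩
  choose z yz hz using htail
  have hcoef : ∀ k ≤ N, HasValue ζ
      ((1 - RatFunc.X ^ (8 * k + 1)) / (1 - RatFunc.X) * pochRatio RatFunc.X 1 k ^ 2 *
        RatFunc.X ^ (2 * k) * E k) _ := fun k hk =>
    (((hasValue_qInt hζ (by omega) _).mul ((hasValue_pochRatio_of_le hζ (by omega)).pow 2)).mul
      ((HasValue.ratFuncX ζ).pow _)).mul (hE k hk).1
  have hsumE := HasValue.sum (s := range (N + 1)) fun k hk =>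
    hcoef k (Nat.lt_succ_iff.1 (mem_range.1 hk))
  have hsumz := HasValue.sum (s := range (3 * N)) fun i hi => (hz i (mem_range.1 hi)).1
  refine ⟨_, _, ((hΦ.mul hsumz).sub (hw.mul hv)).sub ((hΦ.mul (hw.pow 2)).mul hsumE), ?_⟩
  rw [← sum_deformedRatio RatFunc.X_ne_zero (fun m hm => one_sub_ratFuncX_pow_ne_zero hm), hsw,
    show 4 * N + 1 = N + 1 + 3 * N by ring, sum_range_add,
    sum_congr (s₁ := range (3 * N)) rfl fun i hi => (hz i (mem_range.1 hi)).2, ← mul_sum]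
  have hmain : ∑ k ∈ range (N + 1), (1 - (RatFunc.X : RatFunc ℚ) ^ (8 * k + 1)) / (1 - RatFunc.X) *
      pochRatio RatFunc.X 1 k ^ 2 * RatFunc.X ^ (2 * k) *
        deformedRatio RatFunc.X (Φ ^ 2 * w) k =
      ∑ k ∈ range (N + 1), summand RatFunc.X k + Φ ^ 2 * w * (Φ * v) +
        (Φ ^ 2 * w) ^ 2 * ∑ k ∈ range (N + 1), (1 - RatFunc.X ^ (8 * k + 1)) / (1 - RatFunc.X) *
          pochRatio RatFunc.X 1 k ^ 2 * RatFunc.X ^ (2 * k) * E k := by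
    rw [← hvΦ, mul_sum, mul_sum, ← sum_add_distrib, ← sum_add_distrib]
    refine sum_congr rfl fun k hk => ?_
    rw [(hE k (Nat.lt_succ_iff.1 (mem_range.1 hk))).2, summand]
    ring
  rw [hmain]
  ring

end primitive

theorem qPoch_div_qPoch {F : Type*} [Field F] (q : F) (e k : ℕ) :
    qPoch (q ^ e) (q ^ 4) k / qPoch (q ^ 4) (q ^ 4) k = pochRatio q e k := by
  rw [qPoch, qPoch, ← prod_div_distrib]
  refine prod_congr rfl fun i _ => ?_
  rw [← pow_mul, ← pow_add, ← pow_add, add_comm e, add_comm 4]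

theorem cyclotomic_dvd_num_difference {N d : ℕ} (hd1 : 1 < d) (hd : d ∣ 4 * N + 1) :
    cyclotomic d ℚ ∣ ((∑ k ∈ range (4 * N + 1), summand (RatFunc.X : RatFunc ℚ) k) -
        pochRatio RatFunc.X 2 N * ((1 - RatFunc.X ^ (4 * N + 1)) / (1 - RatFunc.X)) *
          (RatFunc.X ^ N)⁻¹).num := by
  have hζ := Complex.isPrimitiveRoot_exp d (by omega)
  have hcop : d.Coprime 4 := Nat.Coprime.coprime_dvd_left hd (by norm_num)
  have hmod : d ∣ 4 * (N % d) + 1 := by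
    rw [← Nat.modEq_zero_iff_dvd] at hd ⊢
    exact ((((Nat.mod_modEq N d).mul_left 4).add_right 1).trans hd)
  obtain ⟨m, hm⟩ := hd
  have h := (hasValue_sum_summand hζ hcop hd1 (Nat.mod_lt _ (by omega)) hmod m).sub
    (hasValue_closed_form hζ hcop hd1 ⟨m, hm⟩)
  rw [sub_zero, ← hm] at h
  obtain ⟨z, y, hz, hx⟩ := h.exists_cyclotomic_mul (by omega) hζ
  rw [hx]
  simpa using hz.cyclotomic_pow_dvd_num (by omega) hζ 1

theorem modulus_dvd_num_difference {N : ℕ} (hN : 0 < N) :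
    (∑ i ∈ range (4 * N + 1), (X : ℚ[X]) ^ i) * cyclotomic (4 * N + 1) ℚ ^ 2 ∣
      ((∑ k ∈ range (4 * N + 1), summand (RatFunc.X : RatFunc ℚ) k) -
        pochRatio RatFunc.X 2 N * ((1 - RatFunc.X ^ (4 * N + 1)) / (1 - RatFunc.X)) *
          (RatFunc.X ^ N)⁻¹).num := by
  have hmem : 4 * N + 1 ∈ (4 * N + 1).divisors.erase 1 := by
    simp [hN.ne']
  rw [← prod_cyclotomic_eq_geom_sum (by omega), ← mul_prod_erase _ _ hmem, mul_right_comm,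
    ← pow_succ']
  refine IsCoprime.mul_dvd ?_ ?_ (prod_dvd_of_coprime ?_ ?_)
  · exact IsCoprime.prod_right fun d hd => (cyclotomic.isCoprime_rat (ne_of_mem_erase hd).symm).pow_left
  · have hζ := Complex.isPrimitiveRoot_exp (4 * N + 1) (by omega)
    obtain ⟨z, y, hz, hx⟩ := exists_difference_eq_cyclotomic_pow_mul hζ hN
    rw [hx]
    exact hz.cyclotomic_pow_dvd_num (by omega) hζ 3
  · exact fun a _ b _ hab => cyclotomic.isCoprime_rat hab
  · intro d hd
    simp only [mem_erase, Nat.mem_divisors] at hd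
    have := Nat.pos_of_dvd_of_pos hd.2.2.1 (by omega)
    exact cyclotomic_dvd_num_difference (by omega) hd.2.2.1

theorem ratCongr_of_dvd_num {M : ℚ[X]} {x : RatFunc ℚ} (h : M ∣ x.num) : ratCongr M x := by
  obtain ⟨f, hf⟩ := h
  refine ⟨f, x.denom, (hf ▸ x.isCoprime_num_denom).of_mul_left_left, ?_⟩
  rw [← map_mul, ← hf]
  have h0 : algebraMap ℚ[X] (RatFunc ℚ) x.denom ≠ 0 := by simpa using x.denom_ne_zero
  rw [← eq_div_iff h0, x.num_div_denom]

/-- First q-analogue of Van Hamme's (G.2), truncated at `n-1`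
(Theorem 1, eq. (1.4) of the paper). -/
theorem stmt3 (n : ℕ) (hn : 0 < n) (hn4 : n % 4 = 1) :
    let q : RatFunc ℚ := RatFunc.X
    ratCongr ((∑ i ∈ Finset.range n, (X : ℚ[X]) ^ i) * cyclotomic n ℚ ^ 2)
      ((∑ k ∈ Finset.range n,
          qInt q (8 * (k : ℤ) + 1) * qPoch q (q ^ 4) k ^ 4 / qPoch (q ^ 4) (q ^ 4) k ^ 4 *
            q ^ (2 * k)) -
        qPoch (q ^ 2) (q ^ 4) ((n - 1) / 4) / qPoch (q ^ 4) (q ^ 4) ((n - 1) / 4) *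
          qInt q (n : ℤ) * q ^ ((1 - (n : ℤ)) / 4)) := by
  intro q
  obtain ⟨N, rfl⟩ : ∃ N, n = 4 * N + 1 := ⟨n / 4, by omega⟩
  have hsum : ∀ k : ℕ, qInt q (8 * (k : ℤ) + 1) * qPoch q (q ^ 4) k ^ 4 /
      qPoch (q ^ 4) (q ^ 4) k ^ 4 * q ^ (2 * k) = summand q k := fun k => by
    have h := qPoch_div_qPoch q 1 k
    rw [pow_one] at h
    rw [summand, ← h, qInt, mul_div_assoc, ← div_pow]
    norm_cast
  rw [sum_congr rfl fun k _ => hsum k, show (4 * N + 1 - 1) / 4 = N by omega,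
    qPoch_div_qPoch, qInt, show (1 - ((4 * N + 1 : ℕ) : ℤ)) / 4 = -(N : ℤ) by omega, zpow_neg,
    zpow_natCast, zpow_natCast]
  rcases N.eq_zero_or_pos with rfl | hN
  · have hq : 1 - q ≠ 0 := by simpa using one_sub_ratFuncX_pow_ne_zero one_pos
    exact ⟨0, 1, isCoprime_one_right, by simp [summand, pochRatio, hq]⟩
  · exact ratCongr_of_dvd_num (modulus_dvd_num_difference hN)
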